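/- The modules L^+(n,0), L^−(n,0), L^+(n,1), L^−(n,1) for n ∈ ℕ, together with L^+(n,01), L^−(n,01) for n ∈ ℕ₊, form a complete list of pairwise non-isomorphic finite-dimensional simple left MU_v(2)-modules: each of these modules is simple, no two of them are isomorphic, and every finite-dimensional simple left MU_v(2)-module is isomorphic to exactly one module in this list. -/

import Mathlib

set_option synthInstance.maxHeartbeats 1000000
set_option maxHeartbeats 1000000

namespace MirabolicSL2

noncomputable section

/-- The base field `K = ℂ(v)`. -/
abbrev K : Type := RatFunc ℂ

/-- The variable `v ∈ ℂ(v)`. -/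
def vv : K := RatFunc.X

/-- The quantum integer `[m] = (v^m - v^{-m})/(v - v⁻¹)`. -/
def qn (m : ℤ) : K := (vv ^ m - vv ^ (-m)) / (vv - vv⁻¹)

/-- The five generators `e, f, k, k⁻¹, ℓ` of mirabolic quantum `sl₂`. -/
inductive G5 : Type | e | f | k | k' | l

open FreeAlgebra in
/-- The defining relations of mirabolic quantum `sl₂`. -/
inductive Rel : FreeAlgebra K G5 → FreeAlgebra K G5 → Prop
  | kk'  : Rel (ι K G5.k * ι K G5.k') 1
  | k'k  : Rel (ι K G5.k' * ι K G5.k) 1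
  | kek' : Rel (ι K G5.k * ι K G5.e * ι K G5.k') ((vv ^ 2) • ι K G5.e)
  | kfk' : Rel (ι K G5.k * ι K G5.f * ι K G5.k') ((vv ^ (-2 : ℤ)) • ι K G5.f)
  | effe : Rel (ι K G5.e * ι K G5.f - ι K G5.f * ι K G5.e)
      (((vv - vv⁻¹)⁻¹) • (ι K G5.k - ι K G5.k'))
  | ll   : Rel (ι K G5.l * ι K G5.l) (ι K G5.l)
  | kl   : Rel (ι K G5.k * ι K G5.l) (ι K G5.l * ι K G5.k)
  | lel  : Rel (ι K G5.l * ι K G5.e * ι K G5.l) (ι K G5.l * ι K G5.e)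
  | lfl  : Rel (ι K G5.l * ι K G5.f * ι K G5.l) (ι K G5.f * ι K G5.l)
  | serreE : Rel ((vv + vv⁻¹) • (ι K G5.e * ι K G5.l * ι K G5.e))
      (vv⁻¹ • (ι K G5.e * ι K G5.e * ι K G5.l) + vv • (ι K G5.l * (ι K G5.e * ι K G5.e)))
  | serreF : Rel ((vv + vv⁻¹) • (ι K G5.f * ι K G5.l * ι K G5.f))
      (vv⁻¹ • (ι K G5.l * (ι K G5.f * ι K G5.f)) + vv • (ι K G5.f * ι K G5.f * ι K G5.l))

/-- Mirabolic quantum `sl₂`: the unital `K`-algebra presented by the generators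
`e, f, k, k⁻¹, ℓ` and the relations `Rel`. -/
abbrev MU2 : Type := RingQuot Rel

/-- The generator `e` of `MU_v(2)`. -/
def Ee : MU2 := RingQuot.mkAlgHom K Rel (FreeAlgebra.ι K G5.e)
/-- The generator `f` of `MU_v(2)`. -/
def Ff : MU2 := RingQuot.mkAlgHom K Rel (FreeAlgebra.ι K G5.f)
/-- The generator `k` of `MU_v(2)`. -/
def Kk : MU2 := RingQuot.mkAlgHom K Rel (FreeAlgebra.ι K G5.k)
/-- The generator `k⁻¹` of `MU_v(2)`. -/
def Kk' : MU2 := RingQuot.mkAlgHom K Rel (FreeAlgebra.ι K G5.k')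
/-- The generator `ℓ` of `MU_v(2)`. -/
def Ll : MU2 := RingQuot.mkAlgHom K Rel (FreeAlgebra.ι K G5.l)

/-- The sign `±1`. -/
def sgn (pos : Bool) : K := if pos then 1 else -1

/-- The index type for the basis of `L^±(n,01)`: `Sum.inl i` is the basis vector
`m_{i,0}` (`0 ≤ i ≤ n-1`) and `Sum.inr j` is the basis vector `m_{j+1,1}`
(so that the second index ranges over `1 ≤ j+1 ≤ n`). -/
abbrev I01 (n : ℕ) : Type := Fin n ⊕ Fin n

/-- The matrix of the action of `k` on `L^±(n,01)`: `k·m_{i,ε} = ±v^{n-2i} m_{i,ε}`. -/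
def kMat01 (pos : Bool) (n : ℕ) : Matrix (I01 n) (I01 n) K := fun b b' =>
  if b = b' then
    (match b with
      | Sum.inl i => sgn pos * vv ^ ((n : ℤ) - 2 * ((i : ℕ) : ℤ))
      | Sum.inr j => sgn pos * vv ^ ((n : ℤ) - 2 * (((j : ℕ) : ℤ) + 1)))
  else 0

/-- The matrix of the action of `ℓ` on `L^±(n,01)`: `ℓ·m_{i,ε} = ε m_{i,ε}`. -/
def lMat01 (n : ℕ) : Matrix (I01 n) (I01 n) K := fun b b' =>
  if b = b' then (match b with | Sum.inl _ => 0 | Sum.inr _ => 1) else 0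

/-- The matrix of the action of `f` on `L^±(n,01)`:
`f·m_{i,0} = m_{i+1,0} + (v^i/[i+1]) m_{i+1,1}`, `f·m_{i,1} = v⁻¹([i]/[i+1]) m_{i+1,1}`. -/
def fMat01 (n : ℕ) : Matrix (I01 n) (I01 n) K := fun b b' =>
  match b, b' with
  | Sum.inl i, Sum.inl i' => if (i : ℕ) = (i' : ℕ) + 1 then 1 else 0
  | Sum.inr j, Sum.inl i' =>
      if (j : ℕ) = (i' : ℕ) then vv ^ ((i' : ℕ) : ℤ) / qn ((i' : ℕ) + 1) else 0
  | Sum.inr j, Sum.inr j' =>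
      if (j : ℕ) = (j' : ℕ) + 1 then vv⁻¹ * qn ((j' : ℕ) + 1) / qn ((j' : ℕ) + 2) else 0
  | Sum.inl _, Sum.inr _ => 0

/-- The matrix of the action of `e` on `L^±(n,01)`:
`e·m_{i,0} = ±v[i][n-i] m_{i-1,0}`,
`e·m_{i,1} = ±[i][n+1-i] m_{i-1,1} ± v^{i-n}[i] m_{i-1,0}`. -/
def eMat01 (pos : Bool) (n : ℕ) : Matrix (I01 n) (I01 n) K := fun b b' =>
  match b, b' with
  | Sum.inl i, Sum.inl i' =>
      if (i : ℕ) + 1 = (i' : ℕ) then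
        sgn pos * vv * qn ((i' : ℕ)) * qn ((n : ℤ) - ((i' : ℕ) : ℤ)) else 0
  | Sum.inl i, Sum.inr j' =>
      if (i : ℕ) = (j' : ℕ) then
        sgn pos * vv ^ ((((j' : ℕ) : ℤ) + 1) - (n : ℤ)) * qn (((j' : ℕ) : ℤ) + 1) else 0
  | Sum.inr j, Sum.inr j' =>
      if (j : ℕ) + 1 = (j' : ℕ) then
        sgn pos * qn (((j' : ℕ) : ℤ) + 1) * qn ((n : ℤ) - ((j' : ℕ) : ℤ)) else 0
  | Sum.inr _, Sum.inl _ => 0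

/-- The matrix of the action of `k` on `L^±(n,ε)`: `k·m_i = ±v^{n-2i} m_i`. -/
def kMatE (pos : Bool) (n : ℕ) : Matrix (Fin (n+1)) (Fin (n+1)) K :=
  Matrix.diagonal (fun i => sgn pos * vv ^ ((n : ℤ) - 2 * ((i : ℕ) : ℤ)))

/-- The matrix of the action of `ℓ` on `L^±(n,ε)`: `ℓ·m_i = ε m_i`. -/
def lMatE (eps : Bool) (n : ℕ) : Matrix (Fin (n+1)) (Fin (n+1)) K :=
  Matrix.diagonal (fun _ => if eps then 1 else 0)

/-- The matrix of the action of `f` on `L^±(n,ε)`: `f·m_i = m_{i+1}` (`m_{n+1} = 0`). -/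
def fMatE (n : ℕ) : Matrix (Fin (n+1)) (Fin (n+1)) K := fun i i' =>
  if (i : ℕ) = (i' : ℕ) + 1 then 1 else 0

/-- The matrix of the action of `e` on `L^±(n,ε)`:
`e·m_i = ±[i][n+1-i] m_{i-1}` (`m_{-1} = 0`). -/
def eMatE (pos : Bool) (n : ℕ) : Matrix (Fin (n+1)) (Fin (n+1)) K := fun i i' =>
  if (i : ℕ) + 1 = (i' : ℕ) then
    sgn pos * qn ((i' : ℕ)) * qn ((n : ℤ) + 1 - ((i' : ℕ) : ℤ)) else 0

/-- Labels for the simple finite dimensional `MU_v(2)`-modules: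
`L^±(n,0)`, `L^±(n,1)` for `n ∈ ℕ` and `L^±(n,01)` for `n ∈ ℕ₊`. -/
inductive Lab : Type
  | L0 (pos : Bool) (n : ℕ)
  | L1 (pos : Bool) (n : ℕ)
  | L01 (pos : Bool) (n : ℕ)

/-- A label is valid when (in the `L^±(n,01)` case) `n ≥ 1`. -/
def Lab.Valid : Lab → Prop
  | .L01 _ n => 1 ≤ n
  | _ => True

/-- The underlying vector space of the module with a given label. -/
def Carrier : Lab → Type
  | .L0 _ n => Fin (n+1) → K
  | .L1 _ n => Fin (n+1) → K
  | .L01 _ n => I01 n → K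

instance instAddCommGroupCarrier : (L : Lab) → AddCommGroup (Carrier L)
  | .L0 _ n => inferInstanceAs (AddCommGroup (Fin (n+1) → K))
  | .L1 _ n => inferInstanceAs (AddCommGroup (Fin (n+1) → K))
  | .L01 _ n => inferInstanceAs (AddCommGroup (I01 n → K))

instance instModuleCarrier : (L : Lab) → Module K (Carrier L)
  | .L0 _ n => inferInstanceAs (Module K (Fin (n+1) → K))
  | .L1 _ n => inferInstanceAs (Module K (Fin (n+1) → K))
  | .L01 _ n => inferInstanceAs (Module K (I01 n → K))

/-- `ρ` is the standard representation of `MU_v(2)` attached to the label `L`. -/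
def IsStd : (L : Lab) → (MU2 →ₐ[K] Module.End K (Carrier L)) → Prop
  | .L0 pos n => fun ρ =>
      ρ Ee = Matrix.toLin' (eMatE pos n) ∧ ρ Ff = Matrix.toLin' (fMatE n) ∧
      ρ Kk = Matrix.toLin' (kMatE pos n) ∧ ρ Ll = Matrix.toLin' (lMatE false n)
  | .L1 pos n => fun ρ =>
      ρ Ee = Matrix.toLin' (eMatE pos n) ∧ ρ Ff = Matrix.toLin' (fMatE n) ∧
      ρ Kk = Matrix.toLin' (kMatE pos n) ∧ ρ Ll = Matrix.toLin' (lMatE true n)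
  | .L01 pos n => fun ρ =>
      ρ Ee = Matrix.toLin' (eMat01 pos n) ∧ ρ Ff = Matrix.toLin' (fMat01 n) ∧
      ρ Kk = Matrix.toLin' (kMat01 pos n) ∧ ρ Ll = Matrix.toLin' (lMat01 n)

/-- A representation of `MU_v(2)` is simple when the space is nonzero and the only
invariant subspaces are `0` and the whole space. -/
def IsSimpleRep {V : Type} [AddCommGroup V] [Module K V]
    (ρ : MU2 →ₐ[K] Module.End K V) : Prop :=
  Nontrivial V ∧
    ∀ W : Submodule K V, (∀ (a : MU2), ∀ x ∈ W, ρ a x ∈ W) → W = ⊥ ∨ W = ⊤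

/-- Isomorphism of representations of `MU_v(2)`. -/
def RepIso {V W : Type} [AddCommGroup V] [Module K V] [AddCommGroup W] [Module K W]
    (ρ : MU2 →ₐ[K] Module.End K V) (τ : MU2 →ₐ[K] Module.End K W) : Prop :=
  ∃ φ : V ≃ₗ[K] W, ∀ (a : MU2) (x : V), φ (ρ a x) = τ a (φ x)

lemma vv_ne_zero : vv ≠ 0 := RatFunc.X_ne_zero

lemma vv_pow_eq_one {m : ℕ} (h : vv ^ m = 1) : m = 0 := by
  have h1 : (algebraMap (Polynomial ℂ) K) (Polynomial.X ^ m) = algebraMap (Polynomial ℂ) K 1 := by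
    rw [map_pow, map_one]
    simpa [vv, RatFunc.algebraMap_X] using h
  have h2 := congrArg Polynomial.natDegree (RatFunc.algebraMap_injective ℂ h1)
  simpa using h2

lemma vv_zpow_eq_one {m : ℤ} (h : vv ^ m = 1) : m = 0 := by
  obtain ⟨k, rfl | rfl⟩ := m.eq_nat_or_neg
  · rw [zpow_natCast] at h
    simp [vv_pow_eq_one h]
  · rw [zpow_neg, inv_eq_one, zpow_natCast] at h
    simp [vv_pow_eq_one h]

lemma vv_zpow_injective {a b : ℤ} (h : vv ^ a = vv ^ b) : a = b := by
  have h1 : vv ^ (a - b) = 1 := by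
    rw [zpow_sub₀ vv_ne_zero, h, div_self (zpow_ne_zero _ vv_ne_zero)]
  have := vv_zpow_eq_one h1
  omega

lemma vv_sub_inv_ne_zero : vv - vv⁻¹ ≠ 0 := by
  intro h
  have h1 : vv ^ (1 : ℤ) = vv ^ (-1 : ℤ) := by
    rw [zpow_one, zpow_neg_one]
    exact sub_eq_zero.mp h
  have := vv_zpow_injective h1
  omega

@[simp] lemma qn_zero : qn 0 = 0 := by simp [qn]

@[simp] lemma qn_one : qn 1 = 1 := by
  rw [qn, zpow_one, zpow_neg_one, div_self vv_sub_inv_ne_zero]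

lemma qn_ne_zero {m : ℤ} (h : m ≠ 0) : qn m ≠ 0 := by
  refine div_ne_zero (fun h1 => h ?_) vv_sub_inv_ne_zero
  have := vv_zpow_injective (sub_eq_zero.mp h1)
  omega

/-- The recursion `[2][m] = [m+1] + [m-1]`. -/
lemma qn_two_mul (m : ℤ) : (vv + vv⁻¹) * qn m = qn (m + 1) + qn (m - 1) := by
  have hv := vv_ne_zero
  have h1 : vv ^ (-(m + 1)) = vv ^ (-m) * vv⁻¹ := by
    rw [neg_add, zpow_add₀ hv, zpow_neg_one]
  have h2 : vv ^ (-(m - 1)) = vv ^ (-m) * vv := by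
    rw [neg_sub', sub_neg_eq_add, zpow_add₀ hv, zpow_one]
  rw [qn, qn, qn, h1, h2, zpow_add₀ hv, zpow_sub₀ hv, zpow_one]
  ring

/-- `[a+1][b] - [a][b+1] = [b-a]`. -/
lemma qn_mul_sub (a b : ℤ) : qn (a + 1) * qn b - qn a * qn (b + 1) = qn (b - a) := by
  have hv := vv_ne_zero
  have hd := vv_sub_inv_ne_zero
  have e (x y : ℤ) : vv ^ (x + y) = vv ^ x * vv ^ y := zpow_add₀ hv x y
  simp only [qn, sub_eq_add_neg b a, neg_add, neg_neg, e, zpow_one, zpow_neg_one]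
  rw [div_mul_div_comm, div_mul_div_comm, ← sub_div, div_eq_div_iff (mul_ne_zero hd hd) hd]
  ring

/-- `v^{-1}[a+1] - v^{-(a+1)} = [a]`. -/
lemma inv_mul_qn_succ (a : ℤ) : vv⁻¹ * qn (a + 1) - vv ^ (-(a + 1)) = qn a := by
  have hv := vv_ne_zero
  have hd := vv_sub_inv_ne_zero
  have e (x y : ℤ) : vv ^ (x + y) = vv ^ x * vv ^ y := zpow_add₀ hv x y
  simp only [qn, neg_add, e, zpow_one, zpow_neg_one]
  rw [← mul_div_assoc, sub_eq_iff_eq_add, div_eq_iff hd, add_mul, div_mul_cancel₀ _ hd]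
  have : vv⁻¹ * vv = 1 := inv_mul_cancel₀ hv
  linear_combination (vv ^ a - vv ^ (-a)) * this

/-- `v[a-1] + v^{-(a-1)} = [a]`. -/
lemma mul_qn_pred (a : ℤ) : vv * qn (a - 1) + vv ^ (1 - a) = qn a := by
  have h1 := inv_mul_qn_succ (a - 1)
  rw [sub_add_cancel] at h1
  rw [sub_eq_add_neg (1 : ℤ), zpow_add₀ vv_ne_zero, zpow_one]
  linear_combination -vv * h1 + qn a * mul_inv_cancel₀ vv_ne_zero

/-- `v^{-1}[a] + v^a = [a+1]`. -/
lemma inv_mul_qn_add (a : ℤ) : vv⁻¹ * qn a + vv ^ a = qn (a + 1) := by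
  have h1 := mul_qn_pred (a + 1)
  rw [add_sub_cancel_right, show (1 : ℤ) - (a + 1) = -a by ring] at h1
  have h2 : qn a * (vv - vv⁻¹) = vv ^ a - vv ^ (-a) := div_mul_cancel₀ _ vv_sub_inv_ne_zero
  linear_combination h1 - h2

@[simp] lemma sgn_mul_sgn (p : Bool) : sgn p * sgn p = 1 := by cases p <;> simp [sgn]

lemma sgn_ne_zero (p : Bool) : sgn p ≠ 0 := by cases p <;> simp [sgn]

lemma sgn_inv (p : Bool) : (sgn p)⁻¹ = sgn p :=
  inv_eq_of_mul_eq_one_left (sgn_mul_sgn p)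

lemma sgn_mul_zpow_injective {p q : Bool} {a b : ℤ} (h : sgn p * vv ^ a = sgn q * vv ^ b) :
    p = q ∧ a = b := by
  have hab : a = b := by
    have h2 : vv ^ (a + a) = vv ^ (b + b) := by
      rw [zpow_add₀ vv_ne_zero, zpow_add₀ vv_ne_zero]
      linear_combination (sgn p * vv ^ a + sgn q * vv ^ b) * h
        - vv ^ a * vv ^ a * sgn_mul_sgn p + vv ^ b * vv ^ b * sgn_mul_sgn q
    have := vv_zpow_injective h2
    omega
  subst hab
  have h3 : sgn p = sgn q := mul_right_cancel₀ (zpow_ne_zero _ vv_ne_zero) h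
  refine ⟨?_, rfl⟩
  have h4 : (1 : K) ≠ -1 := by
    intro h5
    have : (2 : K) = 0 := by linear_combination h5
    exact two_ne_zero this
  cases p <;> cases q <;> simp_all [sgn]

/-- The defining relations of `MU_v(2)`, evaluated on the vectors of a vector space. -/
structure Relations {V : Type} [AddCommGroup V] [Module K V] (E F k k' L : Module.End K V) :
    Prop where
  k_k' : ∀ x, k (k' x) = x
  k'_k : ∀ x, k' (k x) = x
  k_E : ∀ x, k (E x) = vv ^ (2 : ℤ) • E (k x)
  k_F : ∀ x, k (F x) = vv ^ (-2 : ℤ) • F (k x)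
  E_F : ∀ x, E (F x) = F (E x) + (vv - vv⁻¹)⁻¹ • (k x - k' x)
  L_L : ∀ x, L (L x) = L x
  k_L : ∀ x, k (L x) = L (k x)
  L_E_L : ∀ x, L (E (L x)) = L (E x)
  L_F_L : ∀ x, L (F (L x)) = F (L x)
  E_L_E : ∀ x, (vv + vv⁻¹) • E (L (E x)) = vv⁻¹ • E (E (L x)) + vv • L (E (E x))
  F_L_F : ∀ x, (vv + vv⁻¹) • F (L (F x)) = vv⁻¹ • L (F (F x)) + vv • F (F (L x))

section Representation

variable {V : Type} [AddCommGroup V] [Module K V]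

lemma relations_of_rep (ρ : MU2 →ₐ[K] Module.End K V) :
    Relations (ρ Ee) (ρ Ff) (ρ Kk) (ρ Kk') (ρ Ll) := by
  have key {a b : FreeAlgebra K G5} (h : Rel a b) (x : V) :
      ρ (RingQuot.mkAlgHom K Rel a) x = ρ (RingQuot.mkAlgHom K Rel b) x := by
    rw [RingQuot.mkAlgHom_rel K h]
  have hk'k (x : V) : ρ Kk' (ρ Kk x) = x := by simpa [Kk, Kk'] using key Rel.k'k x
  refine ⟨fun x => ?_, hk'k, fun x => ?_, fun x => ?_, fun x => ?_, fun x => ?_, fun x => ?_,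
    fun x => ?_, fun x => ?_, fun x => ?_, fun x => ?_⟩
  · simpa [Kk, Kk'] using key Rel.kk' x
  · have h : ρ Kk (ρ Ee (ρ Kk' (ρ Kk x))) = vv ^ 2 • ρ Ee (ρ Kk x) := by
      simpa [Kk, Kk', Ee] using key Rel.kek' (ρ Kk x)
    rwa [hk'k] at h
  · have h : ρ Kk (ρ Ff (ρ Kk' (ρ Kk x))) = vv ^ (-2 : ℤ) • ρ Ff (ρ Kk x) := by
      simpa [Kk, Kk', Ff] using key Rel.kfk' (ρ Kk x)
    rwa [hk'k] at h
  · have h : ρ Ee (ρ Ff x) - ρ Ff (ρ Ee x) = (vv - vv⁻¹)⁻¹ • (ρ Kk x - ρ Kk' x) := by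
      simpa [Kk, Kk', Ff, Ee] using key Rel.effe x
    rw [← h]
    abel
  · simpa [Ll] using key Rel.ll x
  · simpa [Ll, Kk] using key Rel.kl x
  · simpa [Ll, Ee] using key Rel.lel x
  · simpa [Ll, Ff] using key Rel.lfl x
  · simpa [Ll, Ee] using key Rel.serreE x
  · simpa [Ll, Ff] using key Rel.serreF x

/-- A subspace stable under the generators other than `k⁻¹` is stable under `MU_v(2)`. -/
lemma stable_of_generators [FiniteDimensional K V] (ρ : MU2 →ₐ[K] Module.End K V)
    {W : Submodule K V} (hE : ∀ x ∈ W, ρ Ee x ∈ W) (hF : ∀ x ∈ W, ρ Ff x ∈ W)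
    (hk : ∀ x ∈ W, ρ Kk x ∈ W) (hL : ∀ x ∈ W, ρ Ll x ∈ W) (a : MU2) :
    ∀ x ∈ W, ρ a x ∈ W := by
  have hr := relations_of_rep ρ
  have hk' : ∀ x ∈ W, ρ Kk' x ∈ W := by
    have hinj : Function.Injective (ρ Kk) := fun x y h => by
      rw [← hr.k'_k x, h, hr.k'_k]
    have hle : W.map (ρ Kk) ≤ W := Submodule.map_le_iff_le_comap.mpr hk
    have hmap : W.map (ρ Kk) = W := Submodule.eq_of_le_of_finrank_eq hle
      (Submodule.equivMapOfInjective (ρ Kk) hinj W).finrank_eq.symm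
    intro x hx
    rw [← hmap] at hx
    obtain ⟨y, hy, rfl⟩ := hx
    rwa [hr.k'_k]
  obtain ⟨b, rfl⟩ := RingQuot.mkAlgHom_surjective K Rel a
  induction b using FreeAlgebra.induction with
  | grade0 r =>
    intro x hx
    simpa [Algebra.algebraMap_eq_smul_one] using W.smul_mem r hx
  | grade1 g => cases g <;> assumption
  | mul a b ha hb =>
    intro x hx
    simpa using ha _ (hb _ hx)
  | add a b ha hb =>
    intro x hx
    simpa using W.add_mem (ha _ hx) (hb _ hx)

/-- An operator rescaled by a non-root of unity under conjugation is nilpotent. -/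
lemma isNilpotent_of_conj [FiniteDimensional K V] {A k k' : Module.End K V}
    (hk'k : ∀ x, k' (k x) = x) (hkk' : ∀ x, k (k' x) = x) {m : ℤ} (hm : m ≠ 0)
    (h : ∀ x, k (A x) = vv ^ m • A (k x)) : IsNilpotent A := by
  by_contra hA
  have hpow (i : ℕ) : k * A ^ i * k' = (vv ^ m) ^ i • A ^ i := by
    induction i with
    | zero => ext x; simp [hkk']
    | succ i ih =>
      ext x
      have h1 := LinearMap.congr_fun ih (k (A (k' x)))
      have h2 : k (A (k' x)) = vv ^ m • A x := by rw [h, hkk']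
      simp only [Module.End.mul_apply, hk'k] at h1
      simp only [pow_succ A, Module.End.mul_apply, h1, h2, LinearMap.smul_apply, map_smul,
        smul_smul, pow_succ (vv ^ m), mul_comm]
  let ad : Module.End K (Module.End K V) := LinearMap.mulLeft K k ∘ₗ LinearMap.mulRight K k'
  have heig (i : ℕ) : ad.HasEigenvalue ((vv ^ m) ^ i) := by
    refine Module.End.hasEigenvalue_of_hasEigenvector (x := A ^ i)
      ⟨Module.End.mem_eigenspace_iff.mpr ?_, fun h0 => hA ⟨i, h0⟩⟩
    simpa [ad, mul_assoc] using hpow i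
  have hinj : Function.Injective fun i : ℕ => (vv ^ m) ^ i := by
    intro i j hij
    simp only [← zpow_natCast, ← zpow_mul] at hij
    exact_mod_cast mul_left_cancel₀ hm (vv_zpow_injective hij)
  exact Set.infinite_range_of_injective hinj
    (ad.finite_hasEigenvalue.subset (Set.range_subset_iff.mpr heig))

/-- A nilpotent operator kills a nonzero vector of each nonzero stable subspace. -/
lemma exists_mem_ker {A : Module.End K V} (hA : IsNilpotent A) {U : Submodule K V}
    (hU : ∀ x ∈ U, A x ∈ U) {x : V} (hx : x ∈ U) (hx0 : x ≠ 0) :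
    ∃ y ∈ U, y ≠ 0 ∧ A y = 0 := by
  obtain ⟨r, hr⟩ := hA
  have h : (A ^ r) x = 0 := by rw [hr]; rfl
  clear hr
  induction r generalizing x with
  | zero => exact absurd h hx0
  | succ r ih =>
    by_cases hAx : A x = 0
    · exact ⟨x, hx, hx0, hAx⟩
    · exact ih (hU x hx) hAx (by rwa [pow_succ, Module.End.mul_apply] at h)

namespace Relations

variable {E F k k' L : Module.End K V} (hr : Relations E F k k' L)

include hr

lemma k'_F (x : V) : k' (F x) = vv ^ (2 : ℤ) • F (k' x) := by
  have h := hr.k_F (k' x)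
  rw [hr.k_k'] at h
  rw [← hr.k'_k (F (k' x)), h, map_smul, smul_smul, ← zpow_add₀ vv_ne_zero]
  simp

lemma k'_of_k {x : V} {μ : K} (hμ : μ ≠ 0) (h : k x = μ • x) : k' x = μ⁻¹ • x := by
  have h1 := hr.k'_k x
  rw [h, map_smul] at h1
  rw [eq_inv_smul_iff₀ hμ, h1]

end Relations
end Representation

local instance : Algebra ℕ K := Semiring.toNatAlgebra

local instance : Algebra ℤ K := Ring.toIntAlgebra K

namespace Relations

variable {V : Type} [AddCommGroup V] [Module K V]
  {E F k k' L : Module.End K V} (hr : Relations E F k k' L)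

include hr

lemma k_F_pow (x : V) (i : ℕ) :
    k ((F ^ i) x) = vv ^ (-(2 * i) : ℤ) • (F ^ i) (k x) := by
  induction i with
  | zero => simp
  | succ i ih =>
    rw [pow_succ', Module.End.mul_apply, Module.End.mul_apply, hr.k_F, ih, map_smul, smul_smul,
      ← zpow_add₀ vv_ne_zero]
    congr 2
    push_cast
    ring

lemma k'_F_pow (x : V) (i : ℕ) :
    k' ((F ^ i) x) = vv ^ (2 * i : ℤ) • (F ^ i) (k' x) := by
  induction i with
  | zero => simp
  | succ i ih =>
    rw [pow_succ', Module.End.mul_apply, Module.End.mul_apply, hr.k'_F, ih, map_smul, smul_smul,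
      ← zpow_add₀ vv_ne_zero]
    congr 2
    push_cast
    ring

lemma E_F_pow {u : V} (hu : E u = 0) (i : ℕ) :
    E ((F ^ (i + 1)) u) = (qn (i + 1) * (vv - vv⁻¹)⁻¹) •
      (F ^ i) (vv ^ (-i : ℤ) • k u - vv ^ (i : ℤ) • k' u) := by
  induction i with
  | zero => simp [hr.E_F, hu]
  | succ i ih =>
    have h1 := mul_qn_pred (i + 2)
    have h2 := inv_mul_qn_add (i + 1)
    rw [show (i : ℤ) + 2 - 1 = i + 1 by ring, show (1 : ℤ) - (i + 2) = -(i + 1) by ring] at h1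
    rw [show (i : ℤ) + 1 + 1 = i + 2 by ring] at h2
    have e1 : vv ^ (-(2 * (i + 1)) : ℤ) = vv ^ (-(i + 1) : ℤ) * vv ^ (-(i + 1) : ℤ) := by
      rw [← zpow_add₀ vv_ne_zero]; congr 1; ring
    have e2 : vv ^ (2 * (i + 1) : ℤ) = vv ^ (i + 1 : ℤ) * vv ^ (i + 1 : ℤ) := by
      rw [← zpow_add₀ vv_ne_zero]; congr 1; ring
    have e3 : vv ^ (-i : ℤ) = vv * vv ^ (-(i + 1) : ℤ) := by
      rw [← zpow_one_add₀ vv_ne_zero]; congr 1; ring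
    have e4 : vv ^ (i : ℤ) = vv⁻¹ * vv ^ (i + 1 : ℤ) := by
      rw [zpow_add_one₀ vv_ne_zero, mul_comm, mul_assoc, mul_inv_cancel₀ vv_ne_zero, mul_one]
    rw [pow_succ' F (i + 1), Module.End.mul_apply, hr.E_F, ih, hr.k_F_pow, hr.k'_F_pow, map_smul,
      ← Module.End.mul_apply F, ← pow_succ']
    push_cast
    rw [show (i : ℤ) + 1 + 1 = i + 2 by ring, e1, e2, e3, e4]
    simp only [map_sub, map_smul]
    match_scalars
    · linear_combination (vv - vv⁻¹)⁻¹ * vv ^ (-(i + 1) : ℤ) * h1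
    · linear_combination -(vv - vv⁻¹)⁻¹ * vv ^ (i + 1 : ℤ) * h2

lemma k'_weight {p : Bool} {m : ℤ} {x : V} (h : k x = (sgn p * vv ^ m) • x) :
    k' x = (sgn p * vv ^ (-m)) • x := by
  rw [hr.k'_of_k (mul_ne_zero (sgn_ne_zero p) (zpow_ne_zero _ vv_ne_zero)) h, mul_inv, sgn_inv,
    zpow_neg]

lemma E_F_weight {p : Bool} {m : ℤ} {x : V} (h : k x = (sgn p * vv ^ m) • x) :
    E (F x) = F (E x) + (sgn p * qn m) • x := by
  rw [hr.E_F, h, hr.k'_weight h, ← sub_smul, smul_smul]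
  congr 2
  rw [qn, div_eq_mul_inv]
  ring

lemma k_F_pow_weight {p : Bool} {m : ℤ} {x : V} (h : k x = (sgn p * vv ^ m) • x) (i : ℕ) :
    k ((F ^ i) x) = (sgn p * vv ^ (m - 2 * i)) • (F ^ i) x := by
  rw [hr.k_F_pow, h, map_smul, smul_smul, sub_eq_add_neg m, zpow_add₀ vv_ne_zero]
  congr 1
  ring

lemma k_L_weight {μ : K} {x : V} (h : k x = μ • x) : k (L x) = μ • L x := by
  rw [hr.k_L, h, map_smul]

lemma E_F_pow_weight {p : Bool} {m : ℤ} {w : V} (hE : E w = 0) (hk : k w = (sgn p * vv ^ m) • w)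
    (i : ℕ) : E ((F ^ (i + 1)) w) = (sgn p * qn (i + 1) * qn (m - i)) • (F ^ i) w := by
  rw [hr.E_F_pow hE, hk, hr.k'_weight hk, smul_smul, smul_smul, ← sub_smul, map_smul, smul_smul]
  congr 1
  have h : qn (m - i) = (vv ^ (-i + m : ℤ) - vv ^ (i + -m : ℤ)) / (vv - vv⁻¹) := by
    rw [qn, neg_sub, show m - i = -i + m by ring, show (i : ℤ) - m = i + -m by ring]
  rw [h, zpow_add₀ vv_ne_zero, zpow_add₀ vv_ne_zero, div_eq_mul_inv]
  ring

/-- Highest weight vectors have nonnegative weight. -/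
lemma weight_nonneg (hF : IsNilpotent F) {p : Bool} {m : ℤ} {w : V} (hE : E w = 0)
    (hk : k w = (sgn p * vv ^ m) • w) (hw : w ≠ 0) :
    ∃ n : ℕ, m = n ∧ (F ^ (n + 1)) w = 0 := by
  obtain ⟨r, hr0⟩ := hF
  obtain ⟨n, hn, hn1⟩ : ∃ n, (F ^ n) w ≠ 0 ∧ (F ^ (n + 1)) w = 0 := by
    by_contra! h
    have h1 (i : ℕ) : (F ^ i) w ≠ 0 := by
      induction i with
      | zero => simpa using hw
      | succ i ih => exact h i ih
    exact h1 r (by rw [hr0]; rfl)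
  refine ⟨n, ?_, hn1⟩
  have h1 := hr.E_F_pow_weight hE hk n
  rw [hn1, map_zero, eq_comm, smul_eq_zero_iff_left hn] at h1
  by_contra hmn
  exact mul_ne_zero (mul_ne_zero (sgn_ne_zero p) (qn_ne_zero (by omega)))
    (qn_ne_zero (by omega)) h1

lemma exists_weight_vector {U : Submodule K V} (hE : ∀ x ∈ U, E x = 0) (hk : ∀ x ∈ U, k x ∈ U)
    (hk' : ∀ x ∈ U, k' x ∈ U) {u : V} (hu : u ∈ U) (hu0 : u ≠ 0) {r : ℕ} (hF : (F ^ r) u = 0) :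
    ∃ w ∈ U, w ≠ 0 ∧ ∃ (p : Bool) (n : ℕ), k w = (sgn p * vv ^ (n : ℤ)) • w := by
  induction r generalizing u with
  | zero => exact absurd hF hu0
  | succ r ih =>
    have h1 := hr.E_F_pow (hE u hu) r
    rw [hF, map_zero, eq_comm, smul_eq_zero_iff_right (mul_ne_zero (qn_ne_zero (by omega))
      (inv_ne_zero vv_sub_inv_ne_zero))] at h1
    by_cases h2 : vv ^ (-r : ℤ) • k u - vv ^ (r : ℤ) • k' u = 0
    · have h3 : k (k u) = (vv ^ (r : ℤ) * vv ^ (r : ℤ)) • u := by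
        have h4 : k u = (vv ^ (r : ℤ) * vv ^ (r : ℤ)) • k' u := by
          rw [mul_smul, ← sub_eq_zero.mp h2, smul_smul, ← zpow_add₀ vv_ne_zero]
          simp
        conv_lhs => rw [h4]
        rw [map_smul, hr.k_k']
      by_cases h4 : k u - vv ^ (r : ℤ) • u = 0
      · exact ⟨u, hu, hu0, true, r, by simpa [sgn] using sub_eq_zero.mp h4⟩
      · refine ⟨_, U.sub_mem (hk u hu) (U.smul_mem _ hu), h4, false, r, ?_⟩
        rw [map_sub, map_smul, h3, show sgn false = -1 by simp [sgn]]
        module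
    · exact ih (U.sub_mem (U.smul_mem _ (hk u hu)) (U.smul_mem _ (hk' u hu))) h2 h1

section Mirabolic

variable {p : Bool} {m : ℤ} {w : V}

lemma F_L_F_pow (hL : L w = 0) (i : ℕ) :
    F (L ((F ^ i) w)) = (vv⁻¹ * qn i / qn (i + 1)) • L ((F ^ (i + 1)) w) := by
  induction i with
  | zero => simp [hL]
  | succ i ih =>
    have h := hr.F_L_F ((F ^ i) w)
    have hp (j : ℕ) (x : V) : F ((F ^ j) x) = (F ^ (j + 1)) x := by
      rw [pow_succ', Module.End.mul_apply]
    rw [ih, hp, hp, map_smul] at h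
    have h1 : (qn (i + 2) / qn (i + 1)) • F (L ((F ^ (i + 1)) w)) =
        vv⁻¹ • L ((F ^ (i + 1 + 1)) w) := by
      have h2 := qn_two_mul (i + 1)
      rw [add_sub_cancel_right, show (i : ℤ) + 1 + 1 = i + 2 by ring] at h2
      have h3 : qn (i + 2) / qn (i + 1) = vv + vv⁻¹ - vv * (vv⁻¹ * qn i / qn (i + 1)) := by
        have h4 : qn ((i : ℤ) + 1) ≠ 0 := qn_ne_zero (by omega)
        have h5 := vv_ne_zero
        rw [eq_sub_iff_add_eq, ← mul_div_assoc, ← mul_assoc, mul_inv_cancel₀ h5, one_mul,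
          ← add_div, div_eq_iff h4, h2]
      rw [h3, sub_smul, h]
      module
    have h6 : qn ((i : ℤ) + 2) ≠ 0 := qn_ne_zero (by omega)
    have h7 : qn ((i : ℤ) + 1) ≠ 0 := qn_ne_zero (by omega)
    rw [← eq_inv_smul_iff₀ (div_ne_zero h6 h7), smul_smul] at h1
    rw [h1]
    push_cast
    rw [show (i : ℤ) + 1 + 1 = i + 2 by ring]
    congr 1
    rw [inv_div]
    ring

lemma E_L_F_mem (hE : E w = 0) (hk : k w = (sgn p * vv ^ m) • w) (hL : L w = 0) :
    E (E (L (F w))) = 0 ∧ L (E (L (F w))) = 0 ∧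
      k (E (L (F w))) = (sgn p * vv ^ m) • E (L (F w)) := by
  have hEF : E (F w) = (sgn p * qn m) • w := by rw [hr.E_F_weight hk, hE, map_zero, zero_add]
  refine ⟨?_, ?_, ?_⟩
  · have h := hr.E_L_E (F w)
    rw [hEF, map_smul, map_smul, map_smul, hL, hE] at h
    simpa [vv_ne_zero] using h.symm
  · rw [hr.L_E_L, hEF, map_smul, hL, smul_zero]
  · rw [hr.k_E, hr.k_L, hr.k_F, hk, map_smul, map_smul, map_smul, map_smul, map_smul, smul_smul,
      smul_smul]
    congr 1
    rw [← mul_assoc, ← zpow_add₀ vv_ne_zero]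
    simp

lemma E_L_F_sq (hE : E w = 0) (hk : k w = (sgn p * vv ^ m) • w) (hL : L w = 0) :
    E (L (F (E (L (F w))))) = (sgn p * vv ^ (1 - m)) • E (L (F w)) := by
  have hky : k (L (F w)) = (sgn p * vv ^ (m - 2)) • L (F w) := by
    simpa using hr.k_L_weight (hr.k_F_pow_weight hk 1)
  have h1 : F (E (L (F w))) = E (F (L (F w))) - (sgn p * qn (m - 2)) • L (F w) := by
    rw [hr.E_F_weight hky, add_sub_cancel_right]
  have h2 : F (L (F w)) = (vv⁻¹ / qn 2) • L ((F ^ 2) w) := by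
    simpa using hr.F_L_F_pow hL 1
  have h3 : L (E (L ((F ^ 2) w))) = (sgn p * qn 2 * qn (m - 1)) • L (F w) := by
    rw [hr.L_E_L]
    simpa using congrArg L (hr.E_F_pow_weight hE hk 1)
  have h4 : L (F (E (L (F w)))) =
      (vv⁻¹ / qn 2 * (sgn p * qn 2 * qn (m - 1)) - sgn p * qn (m - 2)) • L (F w) := by
    rw [h1, map_sub, h2, map_smul, map_smul, h3, smul_smul, map_smul, hr.L_L, ← sub_smul]
  rw [h4, map_smul]
  congr 1
  have h5 := inv_mul_qn_succ (m - 2)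
  rw [show m - 2 + 1 = m - 1 by ring, show -(m - 1) = 1 - m by ring] at h5
  have h6 : qn 2 ≠ 0 := qn_ne_zero (by norm_num)
  have h7 : vv⁻¹ / qn 2 * (sgn p * qn 2 * qn (m - 1)) = sgn p * (vv⁻¹ * qn (m - 1)) := by
    rw [div_mul_eq_mul_div, div_eq_iff h6]
    ring
  rw [h7]
  linear_combination sgn p * h5

lemma L_F_pow_succ (hL : L w = 0) (i : ℕ) :
    L ((F ^ (i + 2)) w) = (vv * qn (i + 2) / qn (i + 1)) • F (L ((F ^ (i + 1)) w)) := by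
  rw [hr.F_L_F_pow hL, smul_smul]
  push_cast
  rw [show (i : ℤ) + 1 + 1 = i + 2 by ring]
  have h6 : qn ((i : ℤ) + 2) ≠ 0 := qn_ne_zero (by omega)
  have h7 : qn ((i : ℤ) + 1) ≠ 0 := qn_ne_zero (by omega)
  have h8 := vv_ne_zero
  have : vv * qn (i + 2) / qn (i + 1) * (vv⁻¹ * qn (i + 1) / qn (i + 2)) = 1 := by
    field_simp
  rw [this, one_smul]

lemma exists_E_L_F_pow (hk : k w = (sgn p * vv ^ m) • w) (hL : L w = 0)
    (hT : E (L (F w)) = 0) (i : ℕ) :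
    ∃ a : K, E (L ((F ^ (i + 1)) w)) = a • L ((F ^ i) w) := by
  induction i with
  | zero => exact ⟨0, by simpa using hT⟩
  | succ i ih =>
    obtain ⟨a, ha⟩ := ih
    rw [hr.L_F_pow_succ hL, map_smul,
      hr.E_F_weight (hr.k_L_weight (hr.k_F_pow_weight hk (i + 1))), ha, map_smul,
      hr.F_L_F_pow hL, smul_smul, ← add_smul, smul_smul]
    exact ⟨_, rfl⟩

lemma E_L_F_pow (hk : k w = (sgn p * vv ^ m) • w) (hL : L w = 0)
    (hT : E (L (F w)) = (sgn p * vv ^ (1 - m)) • w) (i : ℕ) :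
    E (L ((F ^ (i + 1)) w)) = (sgn p * qn (i + 1) * qn (m - i)) • L ((F ^ i) w) +
      (sgn p * qn (i + 1) * vv ^ (i + 1 - m)) • ((F ^ i) w - L ((F ^ i) w)) := by
  induction i with
  | zero => simpa [hL] using hT
  | succ i ih =>
    have hp (j : ℕ) (x : V) : F ((F ^ j) x) = (F ^ (j + 1)) x := by
      rw [pow_succ', Module.End.mul_apply]
    rw [hr.L_F_pow_succ hL, map_smul,
      hr.E_F_weight (hr.k_L_weight (hr.k_F_pow_weight hk (i + 1))), ih, map_add, map_smul,
      map_smul, map_sub, hr.F_L_F_pow hL, hp]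
    push_cast
    have h7 : qn ((i : ℤ) + 1) ≠ 0 := qn_ne_zero (by omega)
    have hv := vv_ne_zero
    have e1 : vv ^ (i + 1 + 1 - m : ℤ) = vv * vv ^ (i + 1 - m : ℤ) := by
      rw [← zpow_one_add₀ hv]; congr 1; ring
    have e2 : (i : ℤ) + 1 + 1 = i + 2 := by ring
    have e3 : vv ^ (1 - (m - 2 * i - 1) : ℤ) = vv ^ (i + 1 - m : ℤ) * (vv * vv ^ (i : ℤ)) := by
      rw [← zpow_one_add₀ hv, ← zpow_add₀ hv]; congr 1; ring
    have h1 := qn_mul_sub i (m - i - 1)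
    have h2 := mul_qn_pred (m - 2 * i - 1)
    have h3 := inv_mul_qn_add i
    rw [e3, show m - 2 * i - 1 - 1 = m - 2 * (i + 1) by ring] at h2
    rw [show m - i - 1 + 1 = m - i by ring, show m - i - 1 - i = m - 2 * i - 1 by ring] at h1
    rw [e1, e2, show m - ((i : ℤ) + 1) = m - i - 1 by ring]
    have h4 : qn i * (qn (m - i) - vv ^ (i + 1 - m : ℤ)) + vv * qn (m - 2 * (i + 1)) =
        qn (i + 1) * (qn (m - i - 1) - vv * vv ^ (i + 1 - m : ℤ)) := by
      linear_combination h2 - h1 - vv * vv ^ (i + 1 - m : ℤ) * h3 +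
        qn i * vv ^ (i + 1 - m : ℤ) * mul_inv_cancel₀ hv
    match_scalars
    · field_simp
      linear_combination qn (i + 2) * sgn p * h4
    · field_simp
end Mirabolic

end Relations

section MatrixAction

open Matrix

variable {ι : Type} [Fintype ι] [DecidableEq ι]

/-- The only subspaces stable under four given matrices are `0` and the whole space. -/
def IsSimpleTuple (ME MF MK ML : Matrix ι ι K) : Prop :=
  ∀ W : Submodule K (ι → K), (∀ x ∈ W, ME *ᵥ x ∈ W) → (∀ x ∈ W, MF *ᵥ x ∈ W) →
    (∀ x ∈ W, MK *ᵥ x ∈ W) → (∀ x ∈ W, ML *ᵥ x ∈ W) → W = ⊥ ∨ W = ⊤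

lemma eq_top_of_single_mem {W : Submodule K (ι → K)} (h : ∀ i, Pi.single i 1 ∈ W) : W = ⊤ := by
  rw [eq_top_iff, ← (Pi.basisFun K ι).span_eq, Submodule.span_le]
  rintro _ ⟨i, rfl⟩
  simpa using h i

omit [DecidableEq ι] in
lemma exists_mulVec_eq_zero {M : Matrix ι ι K} {g : ι → ℕ} (hM : ∀ i j, M i j ≠ 0 → g i < g j)
    {W : Submodule K (ι → K)} (hW : ∀ x ∈ W, M *ᵥ x ∈ W) (hW0 : W ≠ ⊥) :
    ∃ y ∈ W, y ≠ 0 ∧ M *ᵥ y = 0 := by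
  obtain ⟨x, hx, hx0⟩ := W.ne_bot_iff.mp hW0
  obtain ⟨N, hN⟩ : ∃ N, ∀ i, x i ≠ 0 → g i < N :=
    ⟨Finset.univ.sup g + 1, fun i _ => Nat.lt_succ_of_le (Finset.le_sup (Finset.mem_univ i))⟩
  induction N generalizing x with
  | zero =>
    refine absurd (funext fun i => ?_) hx0
    by_contra hi
    exact absurd (hN i hi) (by omega)
  | succ N ih =>
    by_cases h : M *ᵥ x = 0
    · exact ⟨x, hx, hx0, h⟩
    · refine ih _ (hW x hx) h fun i hi => ?_
      obtain ⟨j, -, hj⟩ := Finset.exists_ne_zero_of_sum_ne_zero hi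
      have h1 := hM i j (left_ne_zero_of_mul hj)
      have h2 := hN j (right_ne_zero_of_mul hj)
      omega

lemma eMatE_mulVec (p : Bool) (n : ℕ) (x : Fin (n + 1) → K) {i : ℕ} (hi : i < n) :
    (eMatE p n *ᵥ x) ⟨i, by omega⟩ =
      sgn p * qn (i + 1) * qn (n - i) * x ⟨i + 1, by omega⟩ := by
  rw [mulVec, dotProduct, Finset.sum_eq_single ⟨i + 1, by omega⟩]
  · simp [eMatE]
  · intro b _ hb
    have : i + 1 ≠ b := fun h => hb (Fin.ext h.symm)
    simp [eMatE, this]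
  · simp

lemma fMatE_mulVec_single (n i : ℕ) (hi : i < n) :
    fMatE n *ᵥ Pi.single ⟨i, by omega⟩ 1 = Pi.single ⟨i + 1, by omega⟩ 1 := by
  ext j
  simp [fMatE, Pi.single_apply, Fin.ext_iff]

lemma isSimpleTuple_E (p : Bool) (n : ℕ) (MK ML : Matrix (Fin (n + 1)) (Fin (n + 1)) K) :
    IsSimpleTuple (eMatE p n) (fMatE n) MK ML := by
  intro W hE hF _ _
  by_cases hW : W = ⊥
  · exact Or.inl hW
  right
  obtain ⟨y, hy, hy0, hEy⟩ := exists_mulVec_eq_zero (g := fun i : Fin (n + 1) => (i : ℕ))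
    (fun i j h => by
      by_contra hij
      exact h (if_neg (by omega))) hE hW
  have h1 (i : ℕ) (hi : i < n) : y ⟨i + 1, by omega⟩ = 0 := by
    have h2 := eMatE_mulVec p n y hi
    rw [hEy, Pi.zero_apply, eq_comm] at h2
    refine (mul_eq_zero.mp h2).resolve_left (mul_ne_zero (mul_ne_zero (sgn_ne_zero p) ?_) ?_)
    · exact qn_ne_zero (by omega)
    · exact qn_ne_zero (by omega)
  have h2 : y = y 0 • Pi.single 0 1 := by
    ext ⟨i, hi⟩
    cases i with
    | zero => simp
    | succ i => simp [h1 i (by omega), Fin.ext_iff]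
  have h3 : y 0 ≠ 0 := fun h => hy0 (by rw [h2, h, zero_smul])
  have h4 : ∀ i (hi : i < n + 1), Pi.single (⟨i, hi⟩ : Fin (n + 1)) (1 : K) ∈ W := by
    intro i
    induction i with
    | zero =>
      intro _
      rw [h2] at hy
      exact (W.smul_mem_iff h3).mp hy
    | succ i ih =>
      intro hi
      rw [← fMatE_mulVec_single n i (by omega)]
      exact hF _ (ih (by omega))
  exact eq_top_of_single_mem fun i => h4 i i.2

lemma lMat01_eq (n : ℕ) : lMat01 n = diagonal (Sum.elim (fun _ => 0) fun _ => 1) := by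
  ext (i | i) (j | j) <;> simp [lMat01, diagonal_apply]

lemma lMat01_mulVec (n : ℕ) (x : I01 n → K) :
    lMat01 n *ᵥ x = Sum.elim (fun _ => 0) fun i => x (Sum.inr i) := by
  ext (i | i) <;> simp [lMat01_eq, mulVec_diagonal]

lemma eMat01_mulVec_of_inl_eq_zero (p : Bool) (n : ℕ) (x : I01 n → K)
    (hx : ∀ i, x (Sum.inl i) = 0) (i : Fin n) :
    (eMat01 p n *ᵥ x) (Sum.inl i) =
      sgn p * vv ^ ((i : ℤ) + 1 - n) * qn (i + 1) * x (Sum.inr i) := by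
  rw [mulVec, dotProduct, Finset.sum_eq_single (Sum.inr i)]
  · simp [eMat01]
  · rintro (b | b) _ hb
    · simp [hx]
    · have : (i : ℕ) ≠ b := fun h => hb (by rw [Fin.ext h])
      simp [eMat01, this]
  · simp

lemma eMat01_mulVec_of_inr_eq_zero (p : Bool) (n : ℕ) (x : I01 n → K)
    (hx : ∀ i, x (Sum.inr i) = 0) {i : ℕ} (hi : i + 1 < n) :
    (eMat01 p n *ᵥ x) (Sum.inl ⟨i, by omega⟩) =
      sgn p * vv * qn (i + 1) * qn (n - (i + 1)) * x (Sum.inl ⟨i + 1, hi⟩) := by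
  rw [mulVec, dotProduct, Finset.sum_eq_single (Sum.inl ⟨i + 1, hi⟩)]
  · simp [eMat01]
  · rintro (b | b) _ hb
    · have : i + 1 ≠ b := fun h => hb (by simp [h])
      simp [eMat01, this]
    · simp [hx]
  · simp

/-- The number `i` such that the basis vector of `L^±(n,01)` is `m_{i,ε}`. -/
def depth {n : ℕ} : I01 n → ℕ
  | Sum.inl i => i
  | Sum.inr i => i + 1

lemma eMat01_lowers (p : Bool) (n : ℕ) (i j : I01 n) (h : eMat01 p n i j ≠ 0) :
    depth i < depth j := by
  rcases i with i | i <;> rcases j with j | j <;> simp only [eMat01, depth, ne_eq,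
    ite_eq_right_iff, Classical.not_imp, not_true_eq_false] at h ⊢ <;> omega

lemma isSimpleTuple_01 (p : Bool) (n : ℕ) (MK : Matrix (I01 n) (I01 n) K) :
    IsSimpleTuple (eMat01 p n) (fMat01 n) MK (lMat01 n) := by
  intro W hE hF _ hL
  by_cases hW : W = ⊥
  · exact Or.inl hW
  right
  let U : Submodule K (I01 n → K) := W ⊓ LinearMap.ker (toLin' (lMat01 n))
  have hU (x : I01 n → K) : x ∈ U ↔ x ∈ W ∧ ∀ i, x (Sum.inr i) = 0 := by
    simp [U, lMat01_mulVec, funext_iff]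
  have hUE : ∀ x ∈ U, eMat01 p n *ᵥ x ∈ U := by
    intro x hx
    rw [hU] at hx ⊢
    refine ⟨hE x hx.1, fun i => ?_⟩
    rw [mulVec, dotProduct]
    refine Finset.sum_eq_zero ?_
    rintro (j | j) _
    · simp [eMat01]
    · simp [hx.2]
  have hproj (x : I01 n → K) (hx : x ∈ W) : x - lMat01 n *ᵥ x ∈ U := by
    rw [hU]
    exact ⟨W.sub_mem hx (hL x hx), fun i => by simp [lMat01_mulVec]⟩
  have hU0 : U ≠ ⊥ := by
    obtain ⟨x, hx, hx0⟩ := W.ne_bot_iff.mp hW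
    intro hbot
    have hzero (x : I01 n → K) (hx : x ∈ W) (i : Fin n) : x (Sum.inl i) = 0 := by
      have h := hproj x hx
      rw [hbot, Submodule.mem_bot] at h
      simpa [lMat01_mulVec] using congrFun h (Sum.inl i)
    refine hx0 (funext ?_)
    rintro (i | i)
    · exact hzero x hx i
    · have h := hzero _ (hE x hx) i
      rw [eMat01_mulVec_of_inl_eq_zero p n x (hzero x hx)] at h
      refine (mul_eq_zero.mp h).resolve_left (mul_ne_zero (mul_ne_zero (sgn_ne_zero p) ?_) ?_)
      · exact zpow_ne_zero _ vv_ne_zero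
      · exact qn_ne_zero (by omega)
  obtain ⟨y, hy, hy0, hEy⟩ := exists_mulVec_eq_zero (eMat01_lowers p n) hUE hU0
  rw [hU] at hy
  have h1 (i : ℕ) (hi : i + 1 < n) : y (Sum.inl ⟨i + 1, hi⟩) = 0 := by
    have h2 := eMat01_mulVec_of_inr_eq_zero p n y hy.2 hi
    rw [hEy, Pi.zero_apply, eq_comm] at h2
    refine (mul_eq_zero.mp h2).resolve_left (mul_ne_zero (mul_ne_zero (mul_ne_zero
      (sgn_ne_zero p) vv_ne_zero) ?_) ?_)
    · exact qn_ne_zero (by omega)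
    · exact qn_ne_zero (by omega)
  have hn : 0 < n := by
    by_contra hn
    obtain rfl : n = 0 := by omega
    exact hy0 (Subsingleton.elim _ _)
  have h2 : y = y (Sum.inl ⟨0, hn⟩) • Pi.single (Sum.inl ⟨0, hn⟩) 1 := by
    ext (⟨i, hi⟩ | i)
    · cases i with
      | zero => simp
      | succ i => simp [h1 i hi, Fin.ext_iff]
    · simp [hy.2]
  have h3 : y (Sum.inl ⟨0, hn⟩) ≠ 0 := fun h => hy0 (by rw [h2, h, zero_smul])
  have h4 : ∀ i (hi : i < n), Pi.single (Sum.inl ⟨i, hi⟩ : I01 n) (1 : K) ∈ W := by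
    intro i
    induction i with
    | zero =>
      intro _
      have := hy.1
      rw [h2] at this
      exact (W.smul_mem_iff h3).mp this
    | succ i ih =>
      intro hi
      have h5 := hF _ (ih (by omega))
      convert! W.sub_mem h5 (hL _ h5) using 1
      ext (j | j) <;> simp [lMat01_mulVec, fMat01, Pi.single_apply, Fin.ext_iff]
  refine eq_top_of_single_mem ?_
  rintro (i | i)
  · exact h4 i i.2
  · have h5 := hL _ (hF _ (h4 i i.2))
    have h6 : vv ^ (i : ℤ) / qn (i + 1) ≠ 0 :=
      div_ne_zero (zpow_ne_zero _ vv_ne_zero) (qn_ne_zero (by omega))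
    rw [← W.smul_mem_iff h6]
    convert! h5 using 1
    ext (j | j) <;> simp [lMat01_mulVec, fMat01, Pi.single_apply, Fin.ext_iff]

end MatrixAction

section Completeness

open Matrix

variable {V : Type} [AddCommGroup V] [Module K V]

/-- A nonzero map from a simple tuple of matrices to a simple representation transports the
representation to the matrices. -/
lemma exists_rep_of_intertwiner [FiniteDimensional K V] {ρ : MU2 →ₐ[K] Module.End K V}
    (hρ : IsSimpleRep ρ) {ι : Type} [Fintype ι] [DecidableEq ι] {ME MF MK ML : Matrix ι ι K}
    (hM : IsSimpleTuple ME MF MK ML) {x : ι → V} (hx : x ≠ 0)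
    (hE : ∀ j, ρ Ee (x j) = ∑ i, ME i j • x i) (hF : ∀ j, ρ Ff (x j) = ∑ i, MF i j • x i)
    (hk : ∀ j, ρ Kk (x j) = ∑ i, MK i j • x i) (hL : ∀ j, ρ Ll (x j) = ∑ i, ML i j • x i) :
    ∃ τ : MU2 →ₐ[K] Module.End K (ι → K), (τ Ee = toLin' ME ∧ τ Ff = toLin' MF ∧
      τ Kk = toLin' MK ∧ τ Ll = toLin' ML) ∧ RepIso ρ τ := by
  let φ : (ι → K) →ₗ[K] V := Fintype.linearCombination K x
  have hφ {A : Module.End K V} {M : Matrix ι ι K} (h : ∀ j, A (x j) = ∑ i, M i j • x i)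
      (y : ι → K) : φ (M *ᵥ y) = A (φ y) := by
    have h1 : φ ∘ₗ toLin' M = A ∘ₗ φ := by
      refine (Pi.basisFun K ι).ext fun j => ?_
      simp only [Pi.basisFun_apply, LinearMap.comp_apply, toLin'_apply, φ,
        Fintype.linearCombination_apply_single, one_smul, h, mulVec_single_one]
      rfl
    exact LinearMap.congr_fun h1 y
  have hφ0 : φ ≠ 0 := by
    intro h
    refine hx (funext fun j => ?_)
    simpa [φ, Fintype.linearCombination_apply_single] using
      LinearMap.congr_fun h (Pi.single j 1)
  have hker {A : Module.End K V} {M : Matrix ι ι K} (h : ∀ j, A (x j) = ∑ i, M i j • x i) :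
      ∀ y ∈ LinearMap.ker φ, M *ᵥ y ∈ LinearMap.ker φ := by
    intro y hy
    rw [LinearMap.mem_ker] at hy ⊢
    rw [hφ h, hy, map_zero]
  have hrange {A : Module.End K V} {M : Matrix ι ι K} (h : ∀ j, A (x j) = ∑ i, M i j • x i) :
      ∀ y ∈ LinearMap.range φ, A y ∈ LinearMap.range φ := by
    rintro _ ⟨y, rfl⟩
    exact ⟨_, hφ h y⟩
  have hinj : LinearMap.ker φ = ⊥ :=
    (hM _ (hker hE) (hker hF) (hker hk) (hker hL)).resolve_right fun h =>
      hφ0 (LinearMap.ker_eq_top.mp h)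
  have hsurj : LinearMap.range φ = ⊤ :=
    (hρ.2 _ (stable_of_generators ρ (hrange hE) (hrange hF) (hrange hk)
      (hrange hL))).resolve_left fun h => hφ0 (LinearMap.range_eq_bot.mp h)
  let Φ : (ι → K) ≃ₗ[K] V := LinearEquiv.ofBijective φ
    ⟨LinearMap.ker_eq_bot.mp hinj, LinearMap.range_eq_top.mp hsurj⟩
  let τ : MU2 →ₐ[K] Module.End K (ι → K) := (Φ.symm.conjAlgEquiv K).toAlgHom.comp ρ
  have hτ (a : MU2) (y : ι → K) : τ a y = Φ.symm (ρ a (Φ y)) := rfl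
  have hΦ {a : MU2} {M : Matrix ι ι K} (h : ∀ j, ρ a (x j) = ∑ i, M i j • x i) :
      τ a = toLin' M := by
    refine LinearMap.ext fun y => ?_
    rw [hτ, LinearEquiv.symm_apply_eq, toLin'_apply]
    exact (hφ h y).symm
  exact ⟨τ, ⟨hΦ hE, hΦ hF, hΦ hk, hΦ hL⟩, Φ.symm, fun a y => by rw [hτ, Φ.apply_symm_apply]⟩

lemma sum_ite_eq_smul {N : ℕ} (x : ℕ → V) (c : K) {m : ℕ} (h : N ≤ m → x m = 0) :
    ∑ i : Fin N, (if (i : ℕ) = m then c else 0) • x i = c • x m := by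
  by_cases hm : m < N
  · rw [Finset.sum_eq_single ⟨m, hm⟩]
    · simp
    · intro b _ hb
      rw [if_neg fun h => hb (Fin.ext h), zero_smul]
    · simp
  · rw [h (by omega), smul_zero]
    refine Finset.sum_eq_zero fun i _ => ?_
    rw [if_neg (by omega), zero_smul]

lemma F_apply_pow (F : Module.End K V) (j : ℕ) (x : V) : F ((F ^ j) x) = (F ^ (j + 1)) x := by
  rw [pow_succ', Module.End.mul_apply]

variable [FiniteDimensional K V] {ρ : MU2 →ₐ[K] Module.End K V}

lemma exists_std_of_L_scalar (hρ : IsSimpleRep ρ) {p : Bool} {n : ℕ} {w : V} (hw : w ≠ 0)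
    (hE : ρ Ee w = 0) (hk : ρ Kk w = (sgn p * vv ^ (n : ℤ)) • w)
    (hF : (ρ Ff ^ (n + 1)) w = 0) (eps : Bool)
    (hL : ∀ i : ℕ, ρ Ll ((ρ Ff ^ i) w) = (if eps then (1 : K) else 0) • (ρ Ff ^ i) w) :
    ∃ τ : MU2 →ₐ[K] Module.End K (Fin (n + 1) → K), (τ Ee = toLin' (eMatE p n) ∧
      τ Ff = toLin' (fMatE n) ∧ τ Kk = toLin' (kMatE p n) ∧ τ Ll = toLin' (lMatE eps n)) ∧
      RepIso ρ τ := by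
  have hr := relations_of_rep ρ
  refine exists_rep_of_intertwiner hρ (isSimpleTuple_E p n _ _)
    (x := fun i => (ρ Ff ^ (i : ℕ)) w) ?_ ?_ ?_ ?_ ?_
  · intro h
    exact hw (by simpa using congrFun h 0)
  · rintro ⟨j, hj⟩
    cases j with
    | zero => simp [eMatE, hE]
    | succ j =>
      simp only [eMatE, add_left_inj]
      rw [sum_ite_eq_smul (fun i => (ρ Ff ^ i) w) _ (fun h => by omega), hr.E_F_pow_weight hE hk]
      push_cast
      rw [add_sub_add_right_eq_sub]
  · intro j
    simp only [fMatE]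
    rw [sum_ite_eq_smul (fun i => (ρ Ff ^ i) w), one_smul, F_apply_pow]
    intro h
    rwa [show (j : ℕ) + 1 = n + 1 by omega]
  · intro j
    simp [kMatE, diagonal_apply, hr.k_F_pow_weight hk]
  · intro j
    simp [lMatE, diagonal_apply, hL]

lemma exists_std_01 (hρ : IsSimpleRep ρ) {p : Bool} {n : ℕ} {w : V} (hw : w ≠ 0)
    (hE : ρ Ee w = 0) (hk : ρ Kk w = (sgn p * vv ^ (n : ℤ)) • w)
    (hF : (ρ Ff ^ (n + 1)) w = 0) (hFn : IsNilpotent (ρ Ff)) (hL : ρ Ll w = 0)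
    (hT : ρ Ee (ρ Ll (ρ Ff w)) = (sgn p * vv ^ (1 - n : ℤ)) • w) :
    1 ≤ n ∧ ∃ τ : MU2 →ₐ[K] Module.End K (I01 n → K), (τ Ee = toLin' (eMat01 p n) ∧
      τ Ff = toLin' (fMat01 n) ∧ τ Kk = toLin' (kMat01 p n) ∧ τ Ll = toLin' (lMat01 n)) ∧
      RepIso ρ τ := by
  have hr := relations_of_rep ρ
  have hn : 1 ≤ n := by
    by_contra hn
    obtain rfl : n = 0 := by omega
    have h : ρ Ff w = 0 := by simpa using hF
    rw [h, map_zero, map_zero, eq_comm] at hT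
    exact smul_ne_zero (mul_ne_zero (sgn_ne_zero p) (zpow_ne_zero _ vv_ne_zero)) hw hT
  refine ⟨hn, ?_⟩
  let y (i : ℕ) : V := ρ Ll ((ρ Ff ^ i) w)
  let z (i : ℕ) : V := (ρ Ff ^ i) w - ρ Ll ((ρ Ff ^ i) w)
  have hy0 : y 0 = 0 := hL
  have hEz0 : ρ Ee (z 0) = 0 := by simp [z, hL, hE]
  have hEz (i : ℕ) : ρ Ee (z (i + 1)) = (sgn p * vv * qn (i + 1) * qn (n - (i + 1))) • z i := by
    have h1 := mul_qn_pred (n - i)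
    rw [show (1 : ℤ) - (n - i) = i + 1 - n by ring, show (n : ℤ) - i - 1 = n - (i + 1) by ring]
      at h1
    simp only [z, map_sub, hr.E_F_pow_weight hE hk, hr.E_L_F_pow hk hL hT, ← h1]
    module
  have hEy (i : ℕ) : ρ Ee (y (i + 1)) = (sgn p * vv ^ (i + 1 - n : ℤ) * qn (i + 1)) • z i +
      (sgn p * qn (i + 1) * qn (n - i)) • y i := by
    simp only [y, z, hr.E_L_F_pow hk hL hT]
    module
  have hFy (i : ℕ) : ρ Ff (y i) = (vv⁻¹ * qn i / qn (i + 1)) • y (i + 1) := hr.F_L_F_pow hL i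
  have hFz (i : ℕ) : ρ Ff (z i) = (1 : K) • z (i + 1) + (vv ^ (i : ℤ) / qn (i + 1)) • y (i + 1) := by
    have h1 : qn ((i : ℤ) + 1) ≠ 0 := qn_ne_zero (by omega)
    have h2 : vv ^ (i : ℤ) / qn (i + 1) = 1 - vv⁻¹ * qn i / qn (i + 1) := by
      rw [eq_sub_iff_add_eq, ← add_div, add_comm, inv_mul_qn_add, div_self h1]
    simp only [y, z, map_sub, F_apply_pow, hr.F_L_F_pow hL, h2]
    module
  have hky (i : ℕ) : ρ Kk (y i) = (sgn p * vv ^ (n - 2 * i : ℤ)) • y i :=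
    hr.k_L_weight (hr.k_F_pow_weight hk i)
  have hkz (i : ℕ) : ρ Kk (z i) = (sgn p * vv ^ (n - 2 * i : ℤ)) • z i := by
    simp only [z, map_sub, hr.k_F_pow_weight hk, hr.k_L_weight (hr.k_F_pow_weight hk i), smul_sub]
  have hLy (i : ℕ) : ρ Ll (y i) = y i := hr.L_L _
  have hLz (i : ℕ) : ρ Ll (z i) = 0 := by simp [z, hr.L_L]
  have hyn : y (n + 1) = 0 := by simp only [y, hF, map_zero]
  have hzn : z n = 0 := by
    by_contra hz
    have h1 : ρ Ee (z n) = 0 := by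
      obtain ⟨m, rfl⟩ : ∃ m, n = m + 1 := ⟨n - 1, by omega⟩
      simp [hEz]
    obtain ⟨m, hm, -⟩ := hr.weight_nonneg hFn h1 (hkz n) hz
    omega
  refine exists_rep_of_intertwiner hρ (isSimpleTuple_01 p n _)
    (x := Sum.elim (fun i => z i) fun i => y (i + 1)) ?_ ?_ ?_ ?_ ?_
  · intro h
    exact hw (by simpa [z, hL] using congrFun h (Sum.inl ⟨0, hn⟩))
  · rintro (⟨j, hj⟩ | ⟨j, hj⟩)
    · simp only [Fintype.sum_sum_type, eMat01, Sum.elim_inl, Sum.elim_inr, zero_smul,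
        Finset.sum_const_zero, add_zero]
      cases j with
      | zero => simpa using hEz0
      | succ j =>
        simp only [add_left_inj]
        rw [sum_ite_eq_smul z _ (fun h => by omega), hEz]
        push_cast
        rfl
    · simp only [Fintype.sum_sum_type, eMat01, Sum.elim_inl, Sum.elim_inr]
      rw [sum_ite_eq_smul z _ (fun h => by omega), hEy]
      congr 1
      cases j with
      | zero => simp [hy0]
      | succ j =>
        simp only [add_left_inj]
        rw [sum_ite_eq_smul (fun i => y (i + 1)) _ (fun h => by omega)]
  · rintro (⟨j, hj⟩ | ⟨j, hj⟩)
    · simp only [Fintype.sum_sum_type, fMat01, Sum.elim_inl, Sum.elim_inr]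
      rw [sum_ite_eq_smul z _ (fun h => by rwa [show j + 1 = n by omega]),
        sum_ite_eq_smul (fun i => y (i + 1)) _ (fun h => by omega), hFz]
    · simp only [Fintype.sum_sum_type, fMat01, Sum.elim_inl, Sum.elim_inr, zero_smul,
        Finset.sum_const_zero, zero_add]
      rw [sum_ite_eq_smul (fun i => y (i + 1)) _
        (fun h => by rwa [show j + 1 = n by omega]), hFy]
      push_cast
      rw [add_assoc (j : ℤ), one_add_one_eq_two]
  · rintro (j | j)
    · simp [kMat01, hkz]
    · simp [kMat01, hky]
  · rintro (j | j)
    · simp [lMat01, hLz]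
    · simp [lMat01, hLy]

/-- In a simple module, a highest weight vector `w` with `ℓ w = 0` and `eℓf w = 0` generates a
module on which `ℓ` vanishes. -/
lemma L_F_pow_eq_zero (hρ : IsSimpleRep ρ) {p : Bool} {m : ℤ} {w : V} (hw : w ≠ 0)
    (hk : ρ Kk w = (sgn p * vv ^ m) • w) (hL : ρ Ll w = 0)
    (hT : ρ Ee (ρ Ll (ρ Ff w)) = 0) (i : ℕ) : ρ Ll ((ρ Ff ^ i) w) = 0 := by
  have hr := relations_of_rep ρ
  let Y : Submodule K V := Submodule.span K (Set.range fun i : ℕ => ρ Ll ((ρ Ff ^ i) w))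
  have hmem (i : ℕ) : ρ Ll ((ρ Ff ^ i) w) ∈ Y := Submodule.subset_span ⟨i, rfl⟩
  have hY {A : Module.End K V} (h : ∀ i : ℕ, A (ρ Ll ((ρ Ff ^ i) w)) ∈ Y) :
      ∀ x ∈ Y, A x ∈ Y := by
    refine fun x hx => (Submodule.span_le (p := Y.comap A)).mpr ?_ hx
    rintro _ ⟨i, rfl⟩
    exact h i
  have hstable : ∀ a : MU2, ∀ x ∈ Y, ρ a x ∈ Y := by
    refine stable_of_generators ρ (hY fun i => ?_) (hY fun i => ?_) (hY fun i => ?_)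
      (hY fun i => ?_)
    · cases i with
      | zero => simp [hL]
      | succ i =>
        obtain ⟨a, ha⟩ := hr.exists_E_L_F_pow hk hL hT i
        rw [ha]
        exact Y.smul_mem _ (hmem i)
    · rw [hr.F_L_F_pow hL]
      exact Y.smul_mem _ (hmem (i + 1))
    · rw [hr.k_L_weight (hr.k_F_pow_weight hk i)]
      exact Y.smul_mem _ (hmem i)
    · rw [hr.L_L]
      exact hmem i
  have hfix : Y ≤ LinearMap.eqLocus (ρ Ll) LinearMap.id := by
    rw [Submodule.span_le]
    rintro _ ⟨i, rfl⟩
    exact hr.L_L _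
  rcases hρ.2 Y hstable with h | h
  · have := hmem i
    rwa [h] at this
  · have h1 : w ∈ Y := h ▸ Submodule.mem_top
    have h2 : ρ Ll w = w := hfix h1
    exact absurd (h2.symm.trans hL) hw

theorem exists_std (hρ : IsSimpleRep ρ) :
    ∃ L : Lab, L.Valid ∧
      ∃ ρL : MU2 →ₐ[K] Module.End K (Carrier L), IsStd L ρL ∧ RepIso ρ ρL := by
  have hr := relations_of_rep ρ
  have hEn : IsNilpotent (ρ Ee) := isNilpotent_of_conj hr.k'_k hr.k_k' (by norm_num) hr.k_E
  have hFn : IsNilpotent (ρ Ff) := isNilpotent_of_conj hr.k'_k hr.k_k' (by norm_num) hr.k_F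
  have hex {U : Submodule K V} (hU0 : U ≠ ⊥) (hUE : ∀ x ∈ U, ρ Ee x ∈ U)
      (hUk : ∀ x ∈ U, ρ Kk x ∈ U) (hUk' : ∀ x ∈ U, ρ Kk' x ∈ U) :
      ∃ w ∈ U, w ≠ 0 ∧ ρ Ee w = 0 ∧ ∃ (p : Bool) (n : ℕ),
        ρ Kk w = (sgn p * vv ^ (n : ℤ)) • w ∧ (ρ Ff ^ (n + 1)) w = 0 := by
    obtain ⟨x, hx, hx0⟩ := U.ne_bot_iff.mp hU0
    obtain ⟨u, hu, hu0, hEu⟩ := exists_mem_ker hEn hUE hx hx0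
    have hk'E (x : V) (h : ρ Ee x = 0) : ρ Ee (ρ Kk' x) = 0 := by
      have h1 := hr.k_E (ρ Kk' x)
      rw [hr.k_k', h, smul_zero] at h1
      rw [← hr.k'_k (ρ Ee (ρ Kk' x)), h1, map_zero]
    have hkE (x : V) (h : ρ Ee x = 0) : ρ Ee (ρ Kk x) = 0 := by
      have h1 := hr.k_E x
      rw [h, map_zero, eq_comm] at h1
      exact (smul_eq_zero_iff_right (zpow_ne_zero _ vv_ne_zero)).mp h1
    obtain ⟨r, hrF⟩ := hFn
    obtain ⟨w, hw, hw0, p, n, hk⟩ := hr.exists_weight_vector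
      (U := U ⊓ LinearMap.ker (ρ Ee)) (fun x hx => hx.2)
      (fun x hx => ⟨hUk x hx.1, hkE x hx.2⟩) (fun x hx => ⟨hUk' x hx.1, hk'E x hx.2⟩)
      ⟨hu, hEu⟩ hu0 (r := r) (by rw [hrF]; rfl)
    obtain ⟨n', hn, hF⟩ := hr.weight_nonneg ⟨r, hrF⟩ hw.2 hk hw0
    obtain rfl : n = n' := by exact_mod_cast hn
    exact ⟨w, hw.1, hw0, hw.2, p, n, hk, hF⟩
  by_cases hker : LinearMap.ker (ρ Ll) = ⊥
  · have hL (x : V) : ρ Ll x = x := LinearMap.ker_eq_bot.mp hker (hr.L_L x)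
    have := hρ.1
    obtain ⟨w, -, hw0, hE, p, n, hk, hF⟩ := hex (U := ⊤) top_ne_bot (by simp) (by simp) (by simp)
    exact ⟨.L1 p n, trivial,
      exists_std_of_L_scalar hρ hw0 hE hk hF true fun i => by simp [hL]⟩
  · have hEL (x : V) (h : ρ Ll x = 0) : ρ Ll (ρ Ee x) = 0 := by
      rw [← hr.L_E_L, h, map_zero, map_zero]
    have hkL (x : V) (h : ρ Ll x = 0) : ρ Ll (ρ Kk x) = 0 := by
      rw [← hr.k_L, h, map_zero]
    have hk'L (x : V) (h : ρ Ll x = 0) : ρ Ll (ρ Kk' x) = 0 := by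
      have h1 := hr.k_L (ρ Kk' x)
      rw [hr.k_k', h] at h1
      rw [← hr.k'_k (ρ Ll (ρ Kk' x)), h1, map_zero]
    obtain ⟨w, hL, hw0, hE, p, n, hk, hF⟩ := hex hker hEL hkL hk'L
    rw [LinearMap.mem_ker] at hL
    by_cases hT : ρ Ee (ρ Ll (ρ Ff w)) = (sgn p * vv ^ (1 - n : ℤ)) • w
    · obtain ⟨hn, τ, hτ⟩ := exists_std_01 hρ hw0 hE hk hF hFn hL hT
      exact ⟨.L01 p n, hn, τ, hτ⟩
    · let w' : V := ρ Ee (ρ Ll (ρ Ff w)) - (sgn p * vv ^ (1 - n : ℤ)) • w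
      have hw' : w' ≠ 0 := sub_ne_zero.mpr hT
      obtain ⟨hE', hL', hk'⟩ := hr.E_L_F_mem hE hk hL
      have hEw : ρ Ee w' = 0 := by simp only [w', map_sub, map_smul, hE', hE, smul_zero, sub_zero]
      have hLw : ρ Ll w' = 0 := by simp only [w', map_sub, map_smul, hL', hL, smul_zero, sub_zero]
      have hkw : ρ Kk w' = (sgn p * vv ^ (n : ℤ)) • w' := by
        simp only [w', map_sub, map_smul, hk', hk]
        module
      have hTw : ρ Ee (ρ Ll (ρ Ff w')) = 0 := by
        simp only [w', map_sub, map_smul, hr.E_L_F_sq hE hk hL, sub_self]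
      obtain ⟨n', hn, hFw⟩ := hr.weight_nonneg hFn hEw hkw hw'
      obtain rfl : n = n' := by exact_mod_cast hn
      exact ⟨.L0 p n, trivial, exists_std_of_L_scalar hρ hw' hEw hkw hFw false
        fun i => by simp [L_F_pow_eq_zero hρ hw' hkw hLw hTw i]⟩

end Completeness

section StandardModules

open Matrix

lemma kMat01_eq (p : Bool) (n : ℕ) : kMat01 p n = diagonal (Sum.elim
    (fun i : Fin n => sgn p * vv ^ ((n : ℤ) - 2 * ((i : ℕ) : ℤ)))
    fun i : Fin n => sgn p * vv ^ ((n : ℤ) - 2 * (((i : ℕ) : ℤ) + 1))) := by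
  ext (i | i) (j | j) <;> simp [kMat01, diagonal_apply]

/-- The sign in the label of a module. -/
def Lab.pos : Lab → Bool
  | .L0 p _ => p
  | .L1 p _ => p
  | .L01 p _ => p

/-- The highest weight in the label of a module. -/
def Lab.weight : Lab → ℕ
  | .L0 _ n => n
  | .L1 _ n => n
  | .L01 _ n => n

lemma isSimpleRep_of_isSimpleTuple {ι : Type} [Fintype ι] [DecidableEq ι] [Nonempty ι]
    {ME MF MK ML : Matrix ι ι K} (hM : IsSimpleTuple ME MF MK ML)
    {ρ : MU2 →ₐ[K] Module.End K (ι → K)} (h : ρ Ee = toLin' ME ∧ ρ Ff = toLin' MF ∧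
      ρ Kk = toLin' MK ∧ ρ Ll = toLin' ML) : IsSimpleRep ρ := by
  obtain ⟨hE, hF, hK, hL⟩ := h
  refine ⟨inferInstance, fun W hW => hM W ?_ ?_ ?_ ?_⟩
  · exact fun x hx => by simpa [hE] using hW Ee x hx
  · exact fun x hx => by simpa [hF] using hW Ff x hx
  · exact fun x hx => by simpa [hK] using hW Kk x hx
  · exact fun x hx => by simpa [hL] using hW Ll x hx

lemma exists_eq_of_diagonal_mulVec {ι : Type} [Fintype ι] [DecidableEq ι] {d : ι → K} {c : K}
    {x : ι → K} (hx : x ≠ 0) (h : toLin' (diagonal d) x = c • x) : ∃ i, c = d i := by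
  obtain ⟨i, hi⟩ := Function.ne_iff.mp hx
  have h1 := congrFun h i
  rw [toLin'_apply, mulVec_diagonal, Pi.smul_apply, smul_eq_mul] at h1
  exact ⟨i, (mul_right_cancel₀ hi h1).symm⟩

lemma diagonal_apply_single {ι : Type} [Fintype ι] [DecidableEq ι] (d : ι → K) (i : ι) :
    toLin' (diagonal d) (Pi.single i 1) = d i • Pi.single i 1 := by
  rw [toLin'_apply, diagonal_mulVec_single, ← Pi.single_smul, smul_eq_mul]

variable {L L' : Lab} {ρ : MU2 →ₐ[K] Module.End K (Carrier L)}
  {ρ' : MU2 →ₐ[K] Module.End K (Carrier L')}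

lemma IsStd.isSimpleRep (hL : L.Valid) (h : IsStd L ρ) : IsSimpleRep ρ := by
  rcases L with ⟨p, n⟩ | ⟨p, n⟩ | ⟨p, n⟩
  · exact isSimpleRep_of_isSimpleTuple (isSimpleTuple_E p n _ _) h
  · exact isSimpleRep_of_isSimpleTuple (isSimpleTuple_E p n _ _) h
  · have : Nonempty (I01 n) := ⟨Sum.inl ⟨0, hL⟩⟩
    exact isSimpleRep_of_isSimpleTuple (isSimpleTuple_01 p n _) h

lemma IsStd.exists_highest_weight_vector (hL : L.Valid) (h : IsStd L ρ) :
    ∃ x ≠ 0, ρ Kk x = (sgn L.pos * vv ^ (L.weight : ℤ)) • x := by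
  rcases L with ⟨p, n⟩ | ⟨p, n⟩ | ⟨p, n⟩
  · refine ⟨(Pi.single 0 1 : Fin (n + 1) → K), by exact Pi.single_ne_zero_iff.mpr one_ne_zero, ?_⟩
    rw [h.2.2.1]
    refine (diagonal_apply_single _ _).trans ?_
    simp [Lab.pos, Lab.weight]
    rfl
  · refine ⟨(Pi.single 0 1 : Fin (n + 1) → K), by exact Pi.single_ne_zero_iff.mpr one_ne_zero, ?_⟩
    rw [h.2.2.1]
    refine (diagonal_apply_single _ _).trans ?_
    simp [Lab.pos, Lab.weight]
    rfl
  · refine ⟨(Pi.single (Sum.inl ⟨0, hL⟩) 1 : I01 n → K),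
      by exact Pi.single_ne_zero_iff.mpr one_ne_zero, ?_⟩
    rw [h.2.2.1, kMat01_eq]
    refine (diagonal_apply_single _ _).trans ?_
    simp [Lab.pos, Lab.weight]
    rfl

lemma IsStd.eigenvalue_eq (h : IsStd L ρ) {c : K} {x : Carrier L} (hx : x ≠ 0)
    (hc : ρ Kk x = c • x) : ∃ i : ℕ, c = sgn L.pos * vv ^ ((L.weight : ℤ) - 2 * i) := by
  rcases L with ⟨p, n⟩ | ⟨p, n⟩ | ⟨p, n⟩
  · rw [h.2.2.1] at hc
    obtain ⟨i, hi⟩ := exists_eq_of_diagonal_mulVec hx hc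
    exact ⟨i, hi⟩
  · rw [h.2.2.1] at hc
    obtain ⟨i, hi⟩ := exists_eq_of_diagonal_mulVec hx hc
    exact ⟨i, hi⟩
  · rw [h.2.2.1, kMat01_eq] at hc
    obtain ⟨i | i, hi⟩ := exists_eq_of_diagonal_mulVec hx hc
    · exact ⟨i, hi⟩
    · exact ⟨i + 1, by simpa [Lab.pos, Lab.weight] using hi⟩

lemma IsStd.pos_eq_and_weight_le (hL : L.Valid) (h : IsStd L ρ) (h' : IsStd L' ρ')
    (hiso : RepIso ρ ρ') : L.pos = L'.pos ∧ L.weight ≤ L'.weight := by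
  obtain ⟨φ, hφ⟩ := hiso
  obtain ⟨x, hx, hk⟩ := h.exists_highest_weight_vector hL
  obtain ⟨i, hi⟩ := h'.eigenvalue_eq (x := φ x) (by simpa using hx)
    (by rw [← hφ, hk, map_smul])
  obtain ⟨hp, hn⟩ := sgn_mul_zpow_injective hi
  exact ⟨hp, by omega⟩

lemma RepIso.symm {V W : Type} [AddCommGroup V] [Module K V] [AddCommGroup W] [Module K W]
    {ρ : MU2 →ₐ[K] Module.End K V} {τ : MU2 →ₐ[K] Module.End K W} (h : RepIso ρ τ) :
    RepIso τ ρ := by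
  obtain ⟨φ, hφ⟩ := h
  exact ⟨φ.symm, fun a x => by rw [LinearEquiv.symm_apply_eq, hφ, LinearEquiv.apply_symm_apply]⟩

lemma RepIso.trans {V W X : Type} [AddCommGroup V] [Module K V] [AddCommGroup W] [Module K W]
    [AddCommGroup X] [Module K X] {ρ : MU2 →ₐ[K] Module.End K V}
    {τ : MU2 →ₐ[K] Module.End K W} {σ : MU2 →ₐ[K] Module.End K X} (h : RepIso ρ τ)
    (h' : RepIso τ σ) : RepIso ρ σ := by
  obtain ⟨φ, hφ⟩ := h
  obtain ⟨ψ, hψ⟩ := h'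
  exact ⟨φ.trans ψ, fun a x => by simp [hφ, hψ]⟩

lemma RepIso.apply_eq_smul_iff {V W : Type} [AddCommGroup V] [Module K V] [AddCommGroup W]
    [Module K W] {ρ : MU2 →ₐ[K] Module.End K V} {τ : MU2 →ₐ[K] Module.End K W}
    (h : RepIso ρ τ) (a : MU2) (c : K) : (∀ x, ρ a x = c • x) ↔ ∀ y, τ a y = c • y := by
  obtain ⟨φ, hφ⟩ := h
  refine ⟨fun h y => ?_, fun h x => φ.injective (by rw [hφ, h, map_smul])⟩
  rw [← φ.apply_symm_apply y, ← hφ, h, map_smul]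

/-- The scalar by which `ℓ` acts on a module with given label, if there is one. -/
def Lab.HasScalar : Lab → K → Prop
  | .L0 _ _ => fun c => c = 0
  | .L1 _ _ => fun c => c = 1
  | .L01 _ _ => fun _ => False

lemma IsStd.apply_Ll_eq_smul_iff (hL : L.Valid) (h : IsStd L ρ) (c : K) :
    (∀ x, ρ Ll x = c • x) ↔ L.HasScalar c := by
  rcases L with ⟨p, n⟩ | ⟨p, n⟩ | ⟨p, n⟩
  · rw [h.2.2.2]
    change (∀ x : Fin (n + 1) → K, toLin' (lMatE false n) x = c • x) ↔ c = 0
    refine ⟨fun h => ?_, ?_⟩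
    · simpa [lMatE, eq_comm] using congrFun (h (Pi.single 0 1)) 0
    · rintro rfl x
      simp [lMatE]
  · rw [h.2.2.2]
    change (∀ x : Fin (n + 1) → K, toLin' (lMatE true n) x = c • x) ↔ c = 1
    refine ⟨fun h => ?_, ?_⟩
    · simpa [lMatE, eq_comm] using congrFun (h (Pi.single 0 1)) 0
    · rintro rfl x
      simp [lMatE]
  · rw [h.2.2.2]
    change (∀ x : I01 n → K, toLin' (lMat01 n) x = c • x) ↔ False
    simp only [toLin'_apply, lMat01_mulVec, iff_false]
    intro h
    have h0 := congrFun (h fun _ => 1) (Sum.inl ⟨0, hL⟩)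
    have h1 := congrFun (h fun _ => 1) (Sum.inr ⟨0, hL⟩)
    simp only [Sum.elim_inl, Sum.elim_inr, Pi.smul_apply, smul_eq_mul, mul_one] at h0 h1
    exact zero_ne_one (h0.trans h1.symm)

lemma IsStd.label_eq (hL : L.Valid) (hL' : L'.Valid) (h : IsStd L ρ) (h' : IsStd L' ρ')
    (hiso : RepIso ρ ρ') : L = L' := by
  obtain ⟨hp, hn⟩ := h.pos_eq_and_weight_le hL h' hiso
  have hn' := hn.antisymm (h'.pos_eq_and_weight_le hL' h hiso.symm).2
  have hs (c : K) : L.HasScalar c ↔ L'.HasScalar c := by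
    rw [← h.apply_Ll_eq_smul_iff hL, ← h'.apply_Ll_eq_smul_iff hL', hiso.apply_eq_smul_iff]
  have h0 := hs 0
  have h1 := hs 1
  clear h h' hiso hs hn
  cases L <;> cases L' <;> simp_all [Lab.HasScalar, Lab.pos, Lab.weight]

end StandardModules

/-- Theorem 5.7: the modules `L^±(n,0)`, `L^±(n,1)` (`n ∈ ℕ`) and `L^±(n,01)`
(`n ∈ ℕ₊`) form a complete list of pairwise non-isomorphic finite dimensional simple
`MU_v(2)`-modules. -/
theorem classification_of_simples :
    (∀ L : Lab, L.Valid → ∀ ρ : MU2 →ₐ[K] Module.End K (Carrier L),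
      IsStd L ρ → IsSimpleRep ρ) ∧
    (∀ L L' : Lab, L.Valid → L'.Valid →
      ∀ (ρ : MU2 →ₐ[K] Module.End K (Carrier L))
        (ρ' : MU2 →ₐ[K] Module.End K (Carrier L')),
        IsStd L ρ → IsStd L' ρ' → RepIso ρ ρ' → L = L') ∧
    (∀ (V : Type) [AddCommGroup V] [Module K V] [FiniteDimensional K V],
      ∀ ρ : MU2 →ₐ[K] Module.End K V, IsSimpleRep ρ →
        ∃! L : Lab, L.Valid ∧
          ∃ ρL : MU2 →ₐ[K] Module.End K (Carrier L), IsStd L ρL ∧ RepIso ρ ρL) := by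
  refine ⟨fun L hL ρ h => h.isSimpleRep hL,
    fun L L' hL hL' ρ ρ' h h' hiso => h.label_eq hL hL' h' hiso, fun V _ _ _ ρ hρ => ?_⟩
  obtain ⟨L, hL, τ, hτ, hiso⟩ := exists_std hρ
  refine ⟨L, ⟨hL, τ, hτ, hiso⟩, ?_⟩
  rintro L' ⟨hL', τ', hτ', hiso'⟩
  exact hτ'.label_eq hL' hL hτ (hiso'.symm.trans hiso)

end

end MirabolicSL2
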